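/- arXiv:2010.12918 — 8 statements merged into one kernel-verified Lean document; each statement's English description precedes it below -/
import Mathlib

section
/- Let α be a finite type and let p, q : α → ℝ be probability distributions (nonnegative functions summing to 1). Let ε ≥ 0 and η be reals with η > 6ε, and suppose ∑_{x∈α} |p x − q x| ≥ η. Define D = {x ∈ α : p x ≤ q x} and U₁ = {x ∈ α : p x > (1 + (η + 6ε)/4) · q x}. Then (∑_{x∈U₁} p x) · (∑_{x∈D} q x) ≥ η(η − 6ε)/8. -/
open Finset

theorem stmt_0 {α : Type*} [Fintype α] (p q : α → ℝ)
    (hp0 : ∀ x, 0 ≤ p x) (hp1 : ∑ x, p x = 1)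
    (hq0 : ∀ x, 0 ≤ q x) (hq1 : ∑ x, q x = 1)
    (ε η : ℝ) (hε : 0 ≤ ε) (hη : η > 6 * ε)
    (hfar : ∑ x, |p x - q x| ≥ η) :
    (∑ x ∈ univ.filter (fun x => p x > (1 + (η + 6 * ε) / 4) * q x), p x) *
      (∑ x ∈ univ.filter (fun x => p x ≤ q x), q x) ≥ η * (η - 6 * ε) / 8 := by
  have hU : (η - 6 * ε) / 4 ≤
      ∑ x ∈ univ.filter (fun x => p x > (1 + (η + 6 * ε) / 4) * q x), p x := by
    have key : ∑ x, (|p x - q x| + (p x - q x)) ≤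
        ∑ x, (2 * (if p x > (1 + (η + 6 * ε) / 4) * q x then p x else 0) +
          (η + 6 * ε) / 2 * q x) := by
      refine sum_le_sum fun x _ => ?_
      have hpx := hp0 x
      have hqx := hq0 x
      have hc : 0 ≤ (η + 6 * ε) / 2 * q x := mul_nonneg (by linarith) hqx
      split_ifs <;> cases abs_cases (p x - q x) <;> linarith
    rw [sum_add_distrib, sum_sub_distrib, sum_add_distrib, ← mul_sum, ← mul_sum,
      ← sum_filter, hp1, hq1] at key
    linarith
  have hD : η / 2 ≤ ∑ x ∈ univ.filter (fun x => p x ≤ q x), q x := by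
    have key : ∑ x, (|p x - q x| - (p x - q x)) ≤
        ∑ x, 2 * (if p x ≤ q x then q x else 0) := by
      refine sum_le_sum fun x _ => ?_
      have hpx := hp0 x
      split_ifs <;> cases abs_cases (p x - q x) <;> linarith
    rw [sum_sub_distrib, sum_sub_distrib, ← mul_sum, ← sum_filter, hp1, hq1] at key
    linarith
  calc η * (η - 6 * ε) / 8 = (η - 6 * ε) / 4 * (η / 2) := by ring
    _ ≤ _ := mul_le_mul hU hD (by linarith) (sum_nonneg fun x _ => hp0 x)
end

section
/- Let α be a finite type and let p, q : α → ℝ be probability distributions (nonnegative functions summing to 1). Let ε ≥ 0 and η be reals with η > 6ε, and suppose ∑_{x∈α} |p x − q x| ≥ η. Define U₁ = {x ∈ α : p x > (1 + (η + 6ε)/4) · q x}. Then ∑_{x∈U₁} p x ≥ (η − 6ε)/4. -/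
open Finset

theorem stmt_3 {α : Type*} [Fintype α] (p q : α → ℝ)
    (hp0 : ∀ x, 0 ≤ p x) (hp1 : ∑ x, p x = 1)
    (hq0 : ∀ x, 0 ≤ q x) (hq1 : ∑ x, q x = 1)
    (ε η : ℝ) (hε : 0 ≤ ε) (hη : η > 6 * ε)
    (hfar : ∑ x, |p x - q x| ≥ η) :
    (∑ x ∈ univ.filter (fun x => p x > (1 + (η + 6 * ε) / 4) * q x), p x)
      ≥ (η - 6 * ε) / 4 := by
  have hc : 0 ≤ (η + 6 * ε) / 4 := by linarith
  -- The positive part of `p - q` is at most `p` on the filtered set plus a multiple of `q`.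
  have key : ∀ x, (|p x - q x| + p x - q x) / 2 ≤
      (if p x > (1 + (η + 6 * ε) / 4) * q x then p x else 0) + (η + 6 * ε) / 4 * q x := by
    intro x
    have hcq := mul_nonneg hc (hq0 x)
    have hp := hp0 x
    have hq := hq0 x
    split_ifs with h <;> rcases abs_cases (p x - q x) with ⟨h1, _⟩ | ⟨h1, _⟩ <;>
      rw [h1] <;> linarith
  have hsum := sum_le_sum fun x (_ : x ∈ univ) => key x
  rw [← sum_div, sum_sub_distrib, sum_add_distrib, sum_add_distrib, ← mul_sum,
    hp1, hq1, ← sum_filter] at hsum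
  linarith
end

section
/- Let p₁, p₂ be positive reals, let ε be a real with 0 < ε < 1, and let g₁, g₂ ≥ 0 be reals with g₁ + g₂ = 1. If g₁ ≤ (1 + ε) · p₁/(p₁ + p₂) and g₂ ≥ (1 − ε) · p₂/(p₁ + p₂), then g₁ ≤ (1 + ε) · p₁ / ((1 + ε) · p₁ + (1 − ε) · p₂). -/
theorem stmt_6 (p₁ p₂ ε g₁ g₂ : ℝ) (hp₁ : 0 < p₁) (hp₂ : 0 < p₂)
    (hε0 : 0 < ε) (hε1 : ε < 1) (hg₁ : 0 ≤ g₁) (hg₂ : 0 ≤ g₂)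
    (hsum : g₁ + g₂ = 1)
    (h₁ : g₁ ≤ (1 + ε) * p₁ / (p₁ + p₂))
    (h₂ : g₂ ≥ (1 - ε) * p₂ / (p₁ + p₂)) :
    g₁ ≤ (1 + ε) * p₁ / ((1 + ε) * p₁ + (1 - ε) * p₂) := by
  have hS : 0 < p₁ + p₂ := add_pos hp₁ hp₂
  have hA : 0 < (1 + ε) * p₁ := by positivity
  have hB : 0 < (1 - ε) * p₂ := mul_pos (sub_pos.2 hε1) hp₂
  rw [le_div_iff₀ hS] at h₁
  rw [ge_iff_le, div_le_iff₀ hS] at h₂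
  have key : g₁ * ((1 - ε) * p₂) ≤ g₂ * ((1 + ε) * p₁) := by
    refine le_of_mul_le_mul_right ?_ hS
    calc g₁ * ((1 - ε) * p₂) * (p₁ + p₂)
        = g₁ * (p₁ + p₂) * ((1 - ε) * p₂) := by ring
      _ ≤ (1 + ε) * p₁ * ((1 - ε) * p₂) := by gcongr
      _ ≤ (1 + ε) * p₁ * (g₂ * (p₁ + p₂)) := by gcongr
      _ = g₂ * ((1 + ε) * p₁) * (p₁ + p₂) := by ring
  rw [le_div_iff₀ (add_pos hA hB)]
  calc g₁ * ((1 + ε) * p₁ + (1 - ε) * p₂)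
      = g₁ * ((1 + ε) * p₁) + g₁ * ((1 - ε) * p₂) := mul_add _ _ _
    _ ≤ g₁ * ((1 + ε) * p₁) + g₂ * ((1 + ε) * p₁) := by gcongr
    _ = (1 + ε) * p₁ := by rw [← add_mul, hsum, one_mul]
end

section
/- Let L, H, p, δ be reals and t ≥ 1 a real with 0 ≤ p ≤ L < H ≤ 1 and 0 < δ < t. Let N be a natural number with N ≥ 8 · ln(t/δ) · H / (H − L)². If X is a Binomial(N, p) random variable, then Pr[X ≥ N·(H + L)/2] ≤ δ/t. -/
open Finset

/-- Exponential Markov bound for the upper tail of a binomial distribution. -/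
theorem binomial_tail_le_exp (N : ℕ) (p a s : ℝ) (hp0 : 0 ≤ p) (hp1 : p ≤ 1) (hs : 0 ≤ s) :
    ∑ j ∈ (range (N + 1)).filter (fun (j : ℕ) => a ≤ (j : ℝ)),
        (N.choose j : ℝ) * p ^ j * (1 - p) ^ (N - j)
      ≤ Real.exp (N * (p * (Real.exp s - 1)) - s * a) := by
  have hq : 0 ≤ 1 - p := by linarith
  calc
    _ ≤ ∑ j ∈ (range (N + 1)).filter (fun (j : ℕ) => a ≤ (j : ℝ)),
        (N.choose j : ℝ) * p ^ j * (1 - p) ^ (N - j) * Real.exp (s * (j - a)) := by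
      refine sum_le_sum fun j hj => le_mul_of_one_le_right (by positivity) ?_
      exact Real.one_le_exp (mul_nonneg hs (sub_nonneg.2 (mem_filter.1 hj).2))
    _ ≤ ∑ j ∈ range (N + 1),
        (N.choose j : ℝ) * p ^ j * (1 - p) ^ (N - j) * Real.exp (s * (j - a)) :=
      sum_le_sum_of_subset_of_nonneg (filter_subset _ _) fun j _ _ => by positivity
    _ = (p * Real.exp s + (1 - p)) ^ N * Real.exp (-(s * a)) := by
      rw [add_pow, sum_mul]
      refine sum_congr rfl fun j _ => ?_
      rw [mul_pow, ← Real.exp_nat_mul, mul_sub, sub_eq_add_neg (s * (j : ℝ)), Real.exp_add,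
        mul_comm s (j : ℝ)]
      ring
    _ ≤ Real.exp (p * (Real.exp s - 1)) ^ N * Real.exp (-(s * a)) := by
      gcongr
      linarith [Real.add_one_le_exp (p * (Real.exp s - 1))]
    _ = _ := by
      rw [← Real.exp_nat_mul, ← Real.exp_add, ← sub_eq_add_neg]

theorem one_sub_two_mul_mul_exp_sub_le {s : ℝ} (h0 : 0 ≤ s) (h1 : 2 * s ≤ 1) :
    (1 - 2 * s) * (Real.exp s - 1 - s) ≤ s ^ 2 / 2 := by
  have h := Real.exp_bound' h0 (by linarith) (n := 3) (by norm_num)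
  norm_num [sum_range_succ, Nat.factorial] at h
  have h2 : Real.exp s - 1 - s ≤ s ^ 2 / 2 + 2 / 9 * s ^ 3 := by linarith
  have h3 := mul_le_mul_of_nonneg_left h2 (by linarith : 0 ≤ 1 - 2 * s)
  nlinarith [pow_nonneg h0 3, pow_nonneg h0 4]

theorem stmt_13 (L H p δ t : ℝ) (ht : 1 ≤ t)
    (hp0 : 0 ≤ p) (hpL : p ≤ L) (hLH : L < H) (hH1 : H ≤ 1)
    (hδ0 : 0 < δ) (hδt : δ < t)
    (N : ℕ) (hN : (N : ℝ) ≥ 8 * Real.log (t / δ) * H / (H - L) ^ 2) :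
    ∑ j ∈ (range (N + 1)).filter (fun (j : ℕ) => (N : ℝ) * (H + L) / 2 ≤ (j : ℝ)),
        (N.choose j : ℝ) * p ^ j * (1 - p) ^ (N - j)
      ≤ δ / t := by
  have hH : 0 < H := by linarith
  have hd : 0 < H - L := sub_pos.2 hLH
  have ht0 : 0 < t := by linarith
  obtain ⟨s, hs⟩ : ∃ s, s = (H - L) / (2 * H) := ⟨_, rfl⟩
  have hs0 : 0 ≤ s := by rw [hs]; positivity
  have hL : L = H * (1 - 2 * s) := by rw [hs]; field_simp; ring
  have hs1 : 2 * s ≤ 1 := by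
    rw [hs, ← mul_div_assoc, div_le_one (by positivity)]
    linarith
  refine (binomial_tail_le_exp N p _ s hp0 (by linarith) hs0).trans ?_
  rw [← Real.exp_log (div_pos hδ0 ht0), Real.exp_le_exp]
  have hlog : Real.log (δ / t) = -Real.log (t / δ) := by rw [← Real.log_inv, inv_div]
  have hrate : p * (Real.exp s - 1) - s * ((H + L) / 2) ≤ -(H * s ^ 2 / 2) := by
    have h1 : p * (Real.exp s - 1) ≤ L * (Real.exp s - 1) :=
      mul_le_mul_of_nonneg_right hpL (by linarith [Real.one_le_exp hs0])
    have h2 := mul_le_mul_of_nonneg_left (one_sub_two_mul_mul_exp_sub_le hs0 hs1) hH.le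
    rw [hL] at h1 ⊢
    linarith
  have hN' : Real.log (t / δ) ≤ N * (H * s ^ 2 / 2) := by
    rw [ge_iff_le, div_le_iff₀ (by positivity)] at hN
    have h : H - L = 2 * H * s := by rw [hL]; ring
    rw [h] at hN
    refine le_of_mul_le_mul_right ?_ (by positivity : 0 < 8 * H)
    linarith
  have := mul_le_mul_of_nonneg_left hrate (Nat.cast_nonneg (α := ℝ) N)
  rw [hlog]
  linarith
end

section
/- Let L, H, p, δ be reals and t ≥ 1 a real with 0 < L < H ≤ p ≤ 1 and 0 < δ < t. Let N be a natural number with N ≥ 8 · ln(t/δ) · H / (H − L)². If X is a Binomial(N, p) random variable, then Pr[X ≤ N·(H + L)/2] ≤ δ/t. -/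
open Finset

theorem exp_neg_le_one_sub_add_sq {s : ℝ} (hs : 0 ≤ s) :
    Real.exp (-s) ≤ 1 - s + s ^ 2 / 2 := by
  have h := Real.quadratic_le_exp_of_nonneg hs
  rw [Real.exp_neg, inv_le_iff_one_le_mul₀ (Real.exp_pos s)]
  have hpos : 0 ≤ 1 - s + s ^ 2 / 2 := by nlinarith [sq_nonneg (s - 1)]
  calc (1 : ℝ) ≤ (1 - s + s ^ 2 / 2) * (1 + s + s ^ 2 / 2) := by
        nlinarith [sq_nonneg (s ^ 2)]
    _ ≤ (1 - s + s ^ 2 / 2) * Real.exp s := by gcongr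

/-- The exponential Markov bound for the lower tail of a binomial distribution. -/
theorem binomial_lower_tail_le_exp_mul_pow (N : ℕ) {p : ℝ} (hp0 : 0 ≤ p) (hp1 : p ≤ 1)
    (a : ℝ) {s : ℝ} (hs : 0 ≤ s) :
    ∑ j ∈ (range (N + 1)).filter (fun (j : ℕ) => (j : ℝ) ≤ a),
        (N.choose j : ℝ) * p ^ j * (1 - p) ^ (N - j)
      ≤ Real.exp (s * a) * (p * Real.exp (-s) + (1 - p)) ^ N := by
  have hq : 0 ≤ 1 - p := sub_nonneg.2 hp1
  rw [add_pow, mul_sum]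
  calc _ ≤ ∑ j ∈ (range (N + 1)).filter (fun (j : ℕ) => (j : ℝ) ≤ a),
        Real.exp (s * a) * ((p * Real.exp (-s)) ^ j * (1 - p) ^ (N - j) * (N.choose j : ℝ)) := by
        refine sum_le_sum fun j hj => ?_
        have hja : (j : ℝ) ≤ a := (mem_filter.1 hj).2
        have hexp : 1 ≤ Real.exp (s * a) * Real.exp (-s) ^ j := by
          rw [← Real.exp_nat_mul, ← Real.exp_add]
          exact Real.one_le_exp (by nlinarith)
        calc (N.choose j : ℝ) * p ^ j * (1 - p) ^ (N - j)
            ≤ (Real.exp (s * a) * Real.exp (-s) ^ j) *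
                ((N.choose j : ℝ) * p ^ j * (1 - p) ^ (N - j)) :=
              le_mul_of_one_le_left (by positivity) hexp
          _ = _ := by rw [mul_pow]; ring
    _ ≤ _ := sum_le_sum_of_subset_of_nonneg (filter_subset _ _)
        fun j _ _ => by positivity

theorem stmt_14 (L H p δ t : ℝ) (ht : 1 ≤ t)
    (hL0 : 0 < L) (hLH : L < H) (hHp : H ≤ p) (hp1 : p ≤ 1)
    (hδ0 : 0 < δ) (hδt : δ < t)
    (N : ℕ) (hN : (N : ℝ) ≥ 8 * Real.log (t / δ) * H / (H - L) ^ 2) :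
    ∑ j ∈ (range (N + 1)).filter (fun (j : ℕ) => (j : ℝ) ≤ (N : ℝ) * (H + L) / 2),
        (N.choose j : ℝ) * p ^ j * (1 - p) ^ (N - j)
      ≤ δ / t := by
  have hH : 0 < H := hL0.trans hLH
  have hp0 : 0 < p := hH.trans_le hHp
  have hHL : 0 < H - L := sub_pos.2 hLH
  have hq : 0 ≤ 1 - p := sub_nonneg.2 hp1
  obtain ⟨s, hs⟩ : ∃ s, s = (H - L) / (2 * H) := ⟨_, rfl⟩
  have hs0 : 0 ≤ s := by rw [hs]; positivity
  have hs1 : s ≤ 1 := by rw [hs, div_le_one (by positivity)]; linarith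
  have hsH : 2 * H * s = H - L := by rw [hs]; field_simp
  have hbase : p * Real.exp (-s) + (1 - p) ≤ Real.exp (-(H * (s - s ^ 2 / 2))) := by
    have h1 := mul_le_mul_of_nonneg_left (exp_neg_le_one_sub_add_sq hs0) hp0.le
    have h2 : H * (s - s ^ 2 / 2) ≤ p * (s - s ^ 2 / 2) :=
      mul_le_mul_of_nonneg_right hHp (by nlinarith)
    have h3 := Real.add_one_le_exp (-(H * (s - s ^ 2 / 2)))
    linarith
  have hlog : Real.log (t / δ) ≤ N * (H * s ^ 2 / 2) := by
    rw [ge_iff_le, div_le_iff₀ (by positivity), ← hsH] at hN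
    have h : 8 * H * Real.log (t / δ) ≤ 8 * H * (N * (H * s ^ 2 / 2)) := by linarith
    exact le_of_mul_le_mul_left h (by positivity)
  have hexponent : s * (N * (H + L) / 2) + N * -(H * (s - s ^ 2 / 2))
      = -(N * (H * s ^ 2 / 2)) := by
    have hL : L = H - 2 * H * s := by linarith
    rw [hL]; ring
  calc _ ≤ Real.exp (s * (N * (H + L) / 2)) * (p * Real.exp (-s) + (1 - p)) ^ N :=
        binomial_lower_tail_le_exp_mul_pow N hp0.le hp1 _ hs0
    _ ≤ Real.exp (s * (N * (H + L) / 2)) * Real.exp (-(H * (s - s ^ 2 / 2))) ^ N := by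
        gcongr
    _ = Real.exp (-(N * (H * s ^ 2 / 2))) := by
        rw [← Real.exp_nat_mul, ← Real.exp_add, hexponent]
    _ ≤ Real.exp (-Real.log (t / δ)) := Real.exp_le_exp.2 (neg_le_neg hlog)
    _ = δ / t := by
        rw [Real.exp_neg, Real.exp_log (by positivity), inv_div]
end

section
/- Let m ≥ 1 be a natural number and let k be an odd natural number with 0 < k < 2^m. Let c₁ c₂ ⋯ c_m be the m-bit binary representation of k (c_m the least significant bit), and define the Boolean function φ_{k,m} : {0,1}^m → {0,1} on variables a₁,…,a_m by φ_{k,m}(a₁,…,a_m) = a₁ C₁ (a₂ C₂ (⋯ (a_{m−1} C_{m−1} a_m)⋯)), where for 1 ≤ j ≤ m−1 the connector C_j is logical OR if c_j = 1 and logical AND if c_j = 0. Then the number of assignments σ ∈ {0,1}^m with φ_{k,m}(σ) = 1 is exactly k. -/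
open Finset

/-- The chain formula on `m` variables with connectors `c` (`c j = true` means the
`j`-th connector is OR, `c j = false` means AND):
`φ(a₁,…,a_m) = a₁ C₁ (a₂ C₂ (⋯ (a_{m−1} C_{m−1} a_m)⋯))`. -/
def chainFormula : (m : ℕ) → (Fin m → Bool) → (Fin m → Bool) → Bool
  | 0, _, _ => true
  | 1, _, a => a 0
  | (m + 2), c, a =>
      if c 0 then a 0 || chainFormula (m + 1) (fun i => c i.succ) (fun i => a i.succ)
      else a 0 && chainFormula (m + 1) (fun i => c i.succ) (fun i => a i.succ)

theorem card_chainFormula_succ_succ (n : ℕ) (c : Fin (n + 2) → Bool) :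
    (univ.filter (fun σ : Fin (n + 2) → Bool => chainFormula (n + 2) c σ = true)).card =
      (if c 0 then 2 ^ (n + 1) else 0) +
        (univ.filter (fun σ : Fin (n + 1) → Bool =>
          chainFormula (n + 1) (fun i => c i.succ) σ = true)).card := by
  rw [card_filter, ← (Fin.consEquiv fun _ : Fin (n + 2) => Bool).sum_comp,
    Fintype.sum_prod_type, Fintype.sum_bool, card_filter]
  cases h : c 0 <;> simp [Fin.consEquiv, chainFormula, h]

theorem card_chainFormula_eq_sum (n : ℕ) (c : Fin (n + 1) → Bool) (hc : c (Fin.last n) = true) :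
    (univ.filter (fun σ : Fin (n + 1) → Bool => chainFormula (n + 1) c σ = true)).card =
      ∑ i : Fin (n + 1), if c i then 2 ^ (n - (i : ℕ)) else 0 := by
  induction n with
  | zero =>
    have h : c 0 = true := hc
    have hcard : (univ.filter (fun σ : Fin 1 → Bool => σ 0 = true)).card = 1 := by decide
    rw [Fin.sum_univ_succ, Fin.sum_univ_zero, if_pos h]
    exact hcard
  | succ n ih =>
    rw [card_chainFormula_succ_succ, Fin.sum_univ_succ, ih (fun i => c i.succ) hc]
    simp

theorem eq_true_of_odd_sum (n : ℕ) (c : Fin (n + 1) → Bool)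
    (hodd : Odd (∑ i : Fin (n + 1), if c i then 2 ^ (n - (i : ℕ)) else 0)) :
    c (Fin.last n) = true := by
  by_contra h
  refine Nat.not_even_iff_odd.2 hodd (even_iff_two_dvd.2 (dvd_sum fun i _ => ?_))
  split_ifs with hi
  · have hne : i ≠ Fin.last n := fun h' => h (h' ▸ hi)
    have hlt := Fin.val_lt_last hne
    exact dvd_pow_self 2 (by omega)
  · exact dvd_zero 2

theorem stmt_15 (m : ℕ) (hm : 1 ≤ m) (k : ℕ) (hk0 : 0 < k) (hk2 : k < 2 ^ m)
    (hodd : Odd k) (c : Fin m → Bool)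
    (hc : k = ∑ i : Fin m, if c i then 2 ^ (m - 1 - (i : ℕ)) else 0) :
    (univ.filter (fun σ : Fin m → Bool => chainFormula m c σ = true)).card = k := by
  obtain ⟨n, rfl⟩ := Nat.exists_eq_add_of_le' hm
  simp only [Nat.add_sub_cancel] at hc
  subst hc
  exact card_chainFormula_eq_sum n c (eq_true_of_odd_sum n c hodd)
end

section
/- Let S be a finite index set. For each i ∈ S, let m_i be a positive natural number, let k_i be a natural number with 0 < k_i < 2^{m_i}, and let A_i ⊆ {0,1}^{m_i} be a set with |A_i| = k_i. Let R ⊆ ({0,1}^S) be a nonempty finite set, and define the extended witness set R̂ = {(σ, τ) : σ ∈ R, τ ∈ ∏_{i∈S} {0,1}^{m_i}, and for every i ∈ S, σ i = 1 ↔ τ i ∈ A_i}. For σ : S → {0,1}, define the literal weight wt(σ) = ∏_{i∈S} (if σ i = 1 then k_i/2^{m_i} else 1 − k_i/2^{m_i}). Then for every σ ∈ R: |{τ : (σ, τ) ∈ R̂}| / |R̂| = wt(σ) / (∑_{σ' ∈ R} wt(σ')). -/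
open Finset

/-- The number of families `τ` that lie in `A i` exactly where `σ i` holds, as the literal weight
of `σ` scaled by the size of the ambient product. -/
theorem card_filter_forall_iff_mem {S : Type*} [Fintype S] [DecidableEq S] (m : S → ℕ)
    (A : (i : S) → Finset (Fin (m i) → Bool)) (σ : S → Bool) :
    ((univ.filter (fun τ : (i : S) → Fin (m i) → Bool =>
        ∀ i, σ i = true ↔ τ i ∈ A i)).card : ℝ)
      = (∏ i : S, (if σ i = true then ((A i).card : ℝ) / 2 ^ m i
          else 1 - ((A i).card : ℝ) / 2 ^ m i)) * ∏ i : S, (2 : ℝ) ^ m i := by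
  have h : univ.filter (fun τ : (i : S) → Fin (m i) → Bool => ∀ i, σ i = true ↔ τ i ∈ A i)
      = Fintype.piFinset (fun i => if σ i = true then A i else (A i)ᶜ) := by
    ext τ
    simp only [mem_filter, mem_univ, true_and, Fintype.mem_piFinset]
    refine forall_congr' fun i => ?_
    by_cases hi : σ i = true <;> simp [hi]
  rw [h, Fintype.card_piFinset, Nat.cast_prod, ← prod_mul_distrib]
  refine prod_congr rfl fun i _ => ?_
  have hpos : (2 : ℝ) ^ m i ≠ 0 := by positivity
  by_cases hi : σ i = true
  · simp only [hi, if_true]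
    field_simp
  · simp only [hi, if_false, Bool.false_eq_true]
    rw [card_compl, Nat.cast_sub (card_le_univ _)]
    simp only [Fintype.card_pi, Fintype.card_bool, prod_const, card_univ, Fintype.card_fin,
      Nat.cast_pow, Nat.cast_ofNat]
    field_simp

theorem stmt_17 {S : Type*} [Fintype S] [DecidableEq S]
    (m : S → ℕ) (hm : ∀ i, 0 < m i)
    (k : S → ℕ) (hk0 : ∀ i, 0 < k i) (hk2 : ∀ i, k i < 2 ^ m i)
    (A : (i : S) → Finset (Fin (m i) → Bool)) (hA : ∀ i, (A i).card = k i)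
    (R : Finset (S → Bool)) (hR : R.Nonempty)
    (Rhat : Finset ((S → Bool) × ((i : S) → Fin (m i) → Bool)))
    (hRhat : Rhat = univ.filter
      (fun st : (S → Bool) × ((i : S) → Fin (m i) → Bool) =>
        st.1 ∈ R ∧ ∀ i, st.1 i = true ↔ st.2 i ∈ A i))
    (wt : (S → Bool) → ℝ)
    (hwt : ∀ σ, wt σ = ∏ i : S,
      (if σ i = true then (k i : ℝ) / 2 ^ m i else 1 - (k i : ℝ) / 2 ^ m i))
    (σ : S → Bool) (hσ : σ ∈ R) :
    ((univ.filter (fun τ : (i : S) → Fin (m i) → Bool => (σ, τ) ∈ Rhat)).card : ℝ)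
        / (Rhat.card : ℝ)
      = wt σ / ∑ σ' ∈ R, wt σ' := by
  subst hRhat
  have hP : (∏ i : S, (2 : ℝ) ^ m i) ≠ 0 := prod_ne_zero_iff.2 fun i _ => by positivity
  have hfiber : ∀ ρ ∈ R, ((univ.filter (fun τ : (i : S) → Fin (m i) → Bool =>
      ∀ i, ρ i = true ↔ τ i ∈ A i)).card : ℝ) = wt ρ * ∏ i : S, (2 : ℝ) ^ m i := by
    intro ρ _
    rw [card_filter_forall_iff_mem, hwt]
    simp only [hA]
  have htotal : ((univ.filter (fun st : (S → Bool) × ((i : S) → Fin (m i) → Bool) =>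
      st.1 ∈ R ∧ ∀ i, st.1 i = true ↔ st.2 i ∈ A i)).card : ℝ)
      = (∑ ρ ∈ R, wt ρ) * ∏ i : S, (2 : ℝ) ^ m i := by
    rw [sum_mul, ← sum_congr rfl hfiber, ← Nat.cast_sum, ← card_sigma]
    congr 1
    refine card_bij' (fun st _ => ⟨st.1, st.2⟩) (fun st _ => (st.1, st.2)) ?_ ?_ ?_ ?_ <;> simp
  rw [htotal]
  simp only [mem_filter, mem_univ, true_and, hσ]
  rw [hfiber σ hσ, mul_div_mul_right _ _ hP]
end

section
/- Let S be a finite index set. For each i ∈ S, let m_i be a positive natural number, let k_i be a natural number with 0 < k_i < 2^{m_i}, and let A_i ⊆ {0,1}^{m_i} be a set with |A_i| = k_i. Let R ⊆ ({0,1}^S) be a nonempty finite set, and define R̂ = {(σ, τ) : σ ∈ R, τ ∈ ∏_{i∈S} {0,1}^{m_i}, and for every i ∈ S, σ i = 1 ↔ τ i ∈ A_i}. For σ : S → {0,1}, define wt(σ) = ∏_{i∈S} (if σ i = 1 then k_i/2^{m_i} else 1 − k_i/2^{m_i}) and W = ∑_{σ' ∈ R} wt(σ'). Let ε ∈ [0,1)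 and let v : R̂ → ℝ satisfy (1 − ε)/|R̂| ≤ v(σ̂) ≤ (1 + ε)/|R̂| for all σ̂ ∈ R̂. Then for every σ ∈ R: (1 − ε)·wt(σ)/W ≤ ∑_{τ : (σ, τ) ∈ R̂} v(σ, τ) ≤ (1 + ε)·wt(σ)/W. -/
open Finset

/-- The number of families `τ` whose `i`-th component lies in `A i` exactly when `σ i` is true,
as a normalized product of densities. -/
theorem card_filter_iff_mem_eq_prod {S : Type*} [Fintype S] [DecidableEq S] {α : S → Type*}
    [∀ i, Fintype (α i)] [∀ i, DecidableEq (α i)] [∀ i, Nonempty (α i)]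
    (A : (i : S) → Finset (α i)) (σ : S → Bool) :
    ((univ.filter (fun τ : (i : S) → α i => ∀ i, σ i = true ↔ τ i ∈ A i)).card : ℝ) =
      (∏ i, (Fintype.card (α i) : ℝ)) * ∏ i,
        (if σ i = true then ((A i).card : ℝ) / Fintype.card (α i)
          else 1 - ((A i).card : ℝ) / Fintype.card (α i)) := by
  have hpi : univ.filter (fun τ : (i : S) → α i => ∀ i, σ i = true ↔ τ i ∈ A i) =
      Fintype.piFinset (fun i => if σ i = true then A i else (A i)ᶜ) := by
    ext τ
    simp only [mem_filter, mem_univ, true_and, Fintype.mem_piFinset]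
    refine forall_congr' fun i => ?_
    by_cases h : σ i = true <;> simp [h]
  rw [hpi, Fintype.card_piFinset, Nat.cast_prod, ← prod_mul_distrib]
  refine prod_congr rfl fun i _ => ?_
  have hpos : (Fintype.card (α i) : ℝ) ≠ 0 := by exact_mod_cast Fintype.card_ne_zero
  by_cases h : σ i = true
  · simp only [h, if_true]
    field_simp
  · rw [if_neg h, if_neg h, card_compl, Nat.cast_sub (card_le_univ _)]
    field_simp

/-- The cardinality of a finset of pairs whose first components lie in `R` is the sum over `R`
of the cardinalities of the fibers. -/
theorem card_eq_sum_card_fiber {α β : Type*} [DecidableEq α] [DecidableEq β] [Fintype β]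
    (T : Finset (α × β)) (R : Finset α) (hT : ∀ p ∈ T, p.1 ∈ R) :
    T.card = ∑ a ∈ R, (univ.filter (fun b => (a, b) ∈ T)).card := by
  rw [card_eq_sum_card_fiberwise (f := Prod.fst) (t := R) hT]
  refine sum_congr rfl fun a _ => ?_
  symm
  refine card_bij (fun b _ => (a, b)) ?_ ?_ ?_
  · simp
  · simp
  · rintro ⟨a', b⟩ h
    obtain ⟨h, rfl⟩ := mem_filter.1 h
    exact ⟨b, by simpa using h, rfl⟩

theorem stmt_18 {S : Type*} [Fintype S] [DecidableEq S]
    (m : S → ℕ) (hm : ∀ i, 0 < m i)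
    (k : S → ℕ) (hk0 : ∀ i, 0 < k i) (hk2 : ∀ i, k i < 2 ^ m i)
    (A : (i : S) → Finset (Fin (m i) → Bool)) (hA : ∀ i, (A i).card = k i)
    (R : Finset (S → Bool)) (hR : R.Nonempty)
    (Rhat : Finset ((S → Bool) × ((i : S) → Fin (m i) → Bool)))
    (hRhat : Rhat = univ.filter
      (fun st : (S → Bool) × ((i : S) → Fin (m i) → Bool) =>
        st.1 ∈ R ∧ ∀ i, st.1 i = true ↔ st.2 i ∈ A i))
    (wt : (S → Bool) → ℝ)
    (hwt : ∀ σ, wt σ = ∏ i : S,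
      (if σ i = true then (k i : ℝ) / 2 ^ m i else 1 - (k i : ℝ) / 2 ^ m i))
    (W : ℝ) (hW : W = ∑ σ' ∈ R, wt σ')
    (ε : ℝ) (hε0 : 0 ≤ ε) (hε1 : ε < 1)
    (v : (S → Bool) × ((i : S) → Fin (m i) → Bool) → ℝ)
    (hv : ∀ σhat ∈ Rhat,
      (1 - ε) / (Rhat.card : ℝ) ≤ v σhat ∧ v σhat ≤ (1 + ε) / (Rhat.card : ℝ))
    (σ : S → Bool) (hσ : σ ∈ R) :
    (1 - ε) * wt σ / W
        ≤ (∑ τ ∈ univ.filter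
            (fun τ : (i : S) → Fin (m i) → Bool => (σ, τ) ∈ Rhat), v (σ, τ)) ∧
    (∑ τ ∈ univ.filter
        (fun τ : (i : S) → Fin (m i) → Bool => (σ, τ) ∈ Rhat), v (σ, τ))
      ≤ (1 + ε) * wt σ / W := by
  have hfiber : ∀ ρ ∈ R, ((univ.filter (fun τ => (ρ, τ) ∈ Rhat)).card : ℝ) =
      (∏ i, (2 : ℝ) ^ m i) * wt ρ := by
    intro ρ hρ
    have h := card_filter_iff_mem_eq_prod A ρ
    simp only [hA, Fintype.card_fun, Fintype.card_bool, Fintype.card_fin, Nat.cast_pow,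
      Nat.cast_ofNat] at h
    rw [hwt, ← h]
    simp [hRhat, hρ]
  have hcard : (Rhat.card : ℝ) = (∏ i, (2 : ℝ) ^ m i) * W := by
    rw [card_eq_sum_card_fiber Rhat R (by simp +contextual [hRhat]), Nat.cast_sum, hW, mul_sum]
    exact sum_congr rfl hfiber
  have hC : (∏ i, (2 : ℝ) ^ m i) ≠ 0 := by positivity
  have hscale : ∀ c : ℝ, c * wt σ / W =
      ((univ.filter (fun τ => (σ, τ) ∈ Rhat)).card : ℝ) * (c / Rhat.card) := by
    intro c
    rw [hfiber σ hσ, hcard, ← mul_div_assoc, mul_assoc, mul_div_mul_left _ _ hC, mul_comm c]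
  rw [hscale, hscale, ← nsmul_eq_mul, ← nsmul_eq_mul]
  exact ⟨card_nsmul_le_sum _ _ _ fun τ hτ => (hv _ (mem_filter.1 hτ).2).1,
    sum_le_card_nsmul _ _ _ fun τ hτ => (hv _ (mem_filter.1 hτ).2).2⟩
end
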